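/- For every partition of X = Option (ZMod 11) into four nonempty subsets A₁, A₂, A₃, A₄, the F-curve degree of D₀ is at least the F-curve degree of D'_𝒫; that is, w₀(A₁∪A₂) + w₀(A₁∪A₃) + w₀(A₁∪A₄) − Σᵢ w₀(Aᵢ) ≥ w'(A₁∪A₂) + w'(A₁∪A₃) + w'(A₁∪A₄) − Σᵢ w'(Aᵢ). -/

import Mathlib

open Finset

/-- The nonzero quadratic residues modulo 11. -/
def Q : Finset (ZMod 11) := {1, 3, 4, 5, 9}

/-- The (11,5,2) biplane: the family of the eleven translates `Q + t` of `Q`. -/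
def biplane : Finset (Finset (ZMod 11)) :=
  (Finset.univ : Finset (ZMod 11)).image fun t => Q.image (· + t)

/-- The 12-element index type of marked points of `Mbar_{0,12}`;
`none` is the 12th marked point. -/
abbrev X : Type := Option (ZMod 11)

/-- The Kapranov coefficient function of the symmetric divisor `D₀`. -/
def d0 : Finset (ZMod 11) → ℤ := fun S =>
  if S.card = 0 then -5
  else if S.card = 1 then -4
  else if S.card = 2 then -3
  else if S.card = 3 then -2
  else if S.card = 4 then -1
  else 0

open Classical in
/-- The Kapranov coefficient function of the divisor `D'_𝒫 = D₀ − D_𝒫`. -/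
noncomputable def dP' : Finset (ZMod 11) → ℤ := fun S =>
  if (S.card = 5 ∨ S.card = 6) ∧ (S ∈ biplane ∨ ∃ B ∈ biplane, Disjoint S B)
    then 1
  else 0

/-- Extension of a Kapranov coefficient function on `Finset (ZMod 11)` to all boundary
classes, indexed by subsets `T ⊆ X`. -/
noncomputable def extendCoeff (e : Finset (ZMod 11) → ℤ) : Finset X → ℤ := fun T =>
  if none ∈ T then e (Finset.univ.filter fun a : ZMod 11 => some a ∈ T)
  else e (Finset.univ.filter fun a : ZMod 11 => some a ∉ T)

theorem mem_biplane {B : Finset (ZMod 11)} : B ∈ biplane ↔ ∃ t, Q.image (· + t) = B := by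
  simp [biplane]

theorem card_of_mem_biplane {B : Finset (ZMod 11)} (hB : B ∈ biplane) : #B = 5 := by
  obtain ⟨t, rfl⟩ := mem_biplane.1 hB
  rw [card_image_of_injective _ (add_left_injective t)]
  rfl

theorem card_inter_translate : ∀ s t : ZMod 11, s ≠ t →
    #(Q.image (· + s) ∩ Q.image (· + t)) = 2 := by
  decide +kernel

theorem card_inter_inter_translate : ∀ r s t : ZMod 11, r ≠ s → r ≠ t → s ≠ t →
    #(Q.image (· + r) ∩ Q.image (· + s) ∩ Q.image (· + t)) ≤ 1 := by
  decide +kernel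

theorem card_inter_of_mem_biplane {B C : Finset (ZMod 11)} (hB : B ∈ biplane)
    (hC : C ∈ biplane) (h : B ≠ C) : #(B ∩ C) = 2 := by
  obtain ⟨s, rfl⟩ := mem_biplane.1 hB
  obtain ⟨t, rfl⟩ := mem_biplane.1 hC
  exact card_inter_translate s t (by rintro rfl; exact h rfl)

theorem card_inter_inter_of_mem_biplane {B C D : Finset (ZMod 11)} (hB : B ∈ biplane)
    (hC : C ∈ biplane) (hD : D ∈ biplane) (hBC : B ≠ C) (hBD : B ≠ D) (hCD : C ≠ D) :
    #(B ∩ C ∩ D) ≤ 1 := by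
  obtain ⟨r, rfl⟩ := mem_biplane.1 hB
  obtain ⟨s, rfl⟩ := mem_biplane.1 hC
  obtain ⟨t, rfl⟩ := mem_biplane.1 hD
  exact card_inter_inter_translate r s t (by rintro rfl; exact hBC rfl)
    (by rintro rfl; exact hBD rfl) (by rintro rfl; exact hCD rfl)

theorem d0_compl (S : Finset (ZMod 11)) : d0 Sᶜ = -((#S - 6 : ℕ) : ℤ) := by
  have h : #Sᶜ = 11 - #S := by rw [card_compl, ZMod.card]
  have h' : #S ≤ 11 := by simpa [ZMod.card] using card_le_univ S
  simp only [d0, h]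
  split_ifs <;> omega

/-- The sets `S` for which the boundary class indexed by `S` has coefficient `1` in `D'_𝒫`. -/
def IsSpecial (S : Finset (ZMod 11)) : Prop :=
  S ∈ biplane ∨ #S = 6 ∧ ((∃ B ∈ biplane, B ⊆ S) ∨ Sᶜ ∈ biplane)

open Classical in
theorem dP'_compl (S : Finset (ZMod 11)) : dP' Sᶜ = if IsSpecial S then 1 else 0 := by
  have h : #Sᶜ = 11 - #S := by rw [card_compl, ZMod.card]
  have h' : #S ≤ 11 := by simpa [ZMod.card] using card_le_univ S
  have hdisj (B : Finset (ZMod 11)) : Disjoint Sᶜ B ↔ B ⊆ S := by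
    rw [disjoint_comm, ← subset_compl_iff_disjoint_right, compl_compl]
  simp only [dP', hdisj]
  congr 1
  rw [eq_iff_iff, IsSpecial]
  constructor
  · rintro ⟨hc, hS⟩
    by_cases h6 : #S = 6
    · exact .inr ⟨h6, hS.symm⟩
    · rcases hS with hS | ⟨B, hB, hBS⟩
      · have := card_of_mem_biplane hS
        omega
      · have := card_of_mem_biplane hB
        rw [← eq_of_subset_of_card_le hBS (by omega)]
        exact .inl hB
  · rintro (hS | ⟨h6, hS⟩)
    · have := card_of_mem_biplane hS
      exact ⟨by omega, .inr ⟨S, hS, Subset.rfl⟩⟩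
    · exact ⟨by omega, hS.symm⟩

theorem IsSpecial.card {S : Finset (ZMod 11)} (h : IsSpecial S) : #S = 5 ∨ #S = 6 :=
  h.imp card_of_mem_biplane And.left

theorem IsSpecial.mem_biplane {S : Finset (ZMod 11)} (h : IsSpecial S) (h5 : #S = 5) :
    S ∈ biplane :=
  h.resolve_right fun h' => by omega

section
variable {A B C : Finset (ZMod 11)}

theorem IsSpecial.of_subset (hA : IsSpecial A) (h5 : #A = 5) (hAB : A ⊆ B) (h6 : #B = 6) :
    IsSpecial B :=
  .inr ⟨h6, .inl ⟨A, hA.mem_biplane h5, hAB⟩⟩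

theorem IsSpecial.compl (hA : IsSpecial A) (h5 : #A = 5) : IsSpecial Aᶜ :=
  .inr ⟨by rw [card_compl, ZMod.card, h5], .inr (by rw [compl_compl]; exact hA.mem_biplane h5)⟩

theorem card_inter_five_five (hA : IsSpecial A) (hB : IsSpecial B) (hA5 : #A = 5)
    (hB5 : #B = 5) : #(A ∩ B) = 2 ∨ #(A ∩ B) = 5 := by
  by_cases h : A = B
  · subst h; simp [hA5]
  · exact .inl (card_inter_of_mem_biplane (hA.mem_biplane hA5) (hB.mem_biplane hB5) h)

theorem card_inter_compl_add : #(A ∩ Bᶜ) + #(A ∩ B) = #A := by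
  rw [← sdiff_eq_inter_compl, card_sdiff_add_card_inter]

theorem card_inter_five_six (hA : IsSpecial A) (hB : IsSpecial B) (hA5 : #A = 5)
    (hB6 : #B = 6) : #(A ∩ B) ≠ 1 ∧ #(A ∩ B) ≠ 4 := by
  have hA' := hA.mem_biplane hA5
  have key (D) (hD : D ∈ biplane) : #(A ∩ D) = 2 ∨ A = D :=
    or_iff_not_imp_right.2 (card_inter_of_mem_biplane hA' hD)
  rcases hB.resolve_left (fun h => by have := card_of_mem_biplane h; omega) with
    ⟨-, ⟨D, hD, hDB⟩ | hD⟩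
  · have h1 := card_le_card (inter_subset_inter_left hDB : A ∩ D ⊆ A ∩ B)
    have h2 := card_inter_add_card_sdiff B A
    have h3 := card_inter_add_card_sdiff D A
    have h4 := card_le_card (sdiff_subset_sdiff hDB (Subset.refl A))
    rw [inter_comm] at h2 h3
    have h5 := card_of_mem_biplane hD
    rcases key D hD with h | rfl
    · omega
    · rw [inter_eq_left.2 hDB]; omega
  · have h1 := card_inter_compl_add (A := A) (B := B)
    rcases key _ hD with h | h
    · omega
    · rw [← h, inter_self] at h1; omega

theorem IsSpecial.inter_of_card (hA : IsSpecial A) (hB : IsSpecial B) (hA6 : #A = 6)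
    (hB6 : #B = 6) (h : #(A ∩ B) = 5) : IsSpecial (A ∩ B) := by
  have hA' := hA.resolve_left (fun h => by have := card_of_mem_biplane h; omega)
  have hB' := hB.resolve_left (fun h => by have := card_of_mem_biplane h; omega)
  have huv := card_union_add_card_inter A B
  have key {D E} (hD : D ∈ biplane) (hE : E ∈ biplane) : #(D ∩ E) = 2 ∨ D = E :=
    or_iff_not_imp_right.2 (card_inter_of_mem_biplane hD hE)
  have mixed {A B D : Finset (ZMod 11)} (hD : D ∈ biplane) (hDA : D ⊆ A) (hB : Bᶜ ∈ biplane)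
      (h6 : #B = 6) : 8 ≤ #(A ∪ B) := by
    have h1 := card_le_card (union_subset_union_left hDA : D ∪ B ⊆ A ∪ B)
    have h2 := card_union_add_card_inter D B
    have h3 := card_inter_compl_add (A := D) (B := B)
    have h4 := card_of_mem_biplane hD
    rcases key hD hB with h | h
    · omega
    · rw [← h, inter_self] at h3; omega
  rcases hA' with ⟨-, ⟨D, hD, hDA⟩ | hD⟩ <;> rcases hB' with ⟨-, ⟨E, hE, hEB⟩ | hE⟩
  · have h5 := card_of_mem_biplane hD
    have h5' := card_of_mem_biplane hE
    rcases key hD hE with h' | rfl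
    · have := card_le_card (union_subset_union hDA hEB)
      have := card_union_add_card_inter D E
      omega
    · left
      rwa [← eq_of_subset_of_card_le (subset_inter hDA hEB) (by omega)]
  · have := mixed hD hDA hE hB6
    omega
  · have := mixed hE hEB hD hA6
    rw [union_comm] at this
    omega
  · have h1 := card_compl (A ∪ B)
    rw [compl_union, ZMod.card] at h1
    rcases key hD hE with h' | h'
    · omega
    · rw [compl_inj_iff.1 h', inter_self] at h
      omega

theorem IsSpecial.sdiff_or_sdiff (hA : IsSpecial A) (hB : IsSpecial B) (hA6 : #A = 6)
    (hB6 : #B = 6) (h : #(A ∩ B) = 1) : IsSpecial (A \ B) ∨ IsSpecial (B \ A) := by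
  have hA' := hA.resolve_left (fun h => by have := card_of_mem_biplane h; omega)
  have hB' := hB.resolve_left (fun h => by have := card_of_mem_biplane h; omega)
  have huv := card_union_add_card_inter A B
  have hU : A ∪ B = univ := by
    rw [← card_eq_iff_eq_univ, ZMod.card]; omega
  rcases hA' with ⟨-, ⟨D, hD, hDA⟩ | hD⟩
  · rcases hB' with ⟨-, ⟨E, hE, hEB⟩ | hE⟩
    · have h1 := card_le_card (inter_subset_inter hDA hEB)
      by_cases hDE : D = E
      · subst hDE
        rw [inter_self, card_of_mem_biplane hD] at h1
        omega
      · rw [card_inter_of_mem_biplane hD hE hDE] at h1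
        omega
    · left; left
      rwa [← union_sdiff_right, hU, ← compl_eq_univ_sdiff]
  · right; left
    rwa [← union_sdiff_left, hU, ← compl_eq_univ_sdiff]

theorem not_isSpecial_union_of_five_five (hAB : Disjoint A B) (hAC : Disjoint A C)
    (hBC : Disjoint B C) (hA : IsSpecial (A ∪ C)) (hB : IsSpecial (B ∪ C)) (hA3 : #A = 3)
    (hB3 : #B = 3) (hC2 : #C = 2) : ¬ IsSpecial (A ∪ B) := by
  intro h
  have hAc := card_union_of_disjoint hAC
  have hBc := card_union_of_disjoint hBC
  have hA' := hA.mem_biplane (by omega)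
  have hB' := hB.mem_biplane (by omega)
  obtain ⟨a, ha⟩ := card_pos.1 (by omega : 0 < #A)
  obtain ⟨b, hb⟩ := card_pos.1 (by omega : 0 < #B)
  obtain ⟨c, hc⟩ := card_pos.1 (by omega : 0 < #C)
  rw [disjoint_left] at hAB hAC hBC
  rcases h with h | ⟨-, ⟨D, hD, hDs⟩ | hD⟩
  · have := card_of_mem_biplane h
    rw [card_union_of_disjoint (disjoint_left.2 hAB)] at this
    omega
  · have hcD : c ∉ D := by grind
    have h1 := card_inter_of_mem_biplane hD hA' (by grind)
    have h2 := card_inter_of_mem_biplane hD hB' (by grind)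
    have h3 : D ⊆ (D ∩ (A ∪ C)) ∪ (D ∩ (B ∪ C)) := by grind
    have h4 := card_le_card h3
    have h5 := card_union_le (D ∩ (A ∪ C)) (D ∩ (B ∪ C))
    have h6 := card_of_mem_biplane hD
    omega
  · have h1 := card_inter_inter_of_mem_biplane hA' hB' hD
      (ne_of_mem_of_not_mem' (a := a) (by grind) (by grind))
      (ne_of_mem_of_not_mem' (a := a) (by grind) (by grind [mem_compl]))
      (ne_of_mem_of_not_mem' (a := b) (by grind) (by grind [mem_compl]))
    have h2 : C ⊆ (A ∪ C) ∩ (B ∪ C) ∩ (A ∪ B)ᶜ := by grind [mem_compl]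
    have := card_le_card h2
    omega

end

theorem dP'_compl_eq_one_iff (S : Finset (ZMod 11)) : dP' Sᶜ = 1 ↔ IsSpecial S := by
  rw [dP'_compl]
  split_ifs <;> simp_all

theorem dP'_compl_eq_zero_or_one (S : Finset (ZMod 11)) : dP' Sᶜ = 0 ∨ dP' Sᶜ = 1 := by
  rw [dP'_compl]
  split_ifs <;> simp

section
variable {A B C : Finset (ZMod 11)}

/-- The constraints on two special sets written as overlapping unions of three disjoint sets. -/
theorem isSpecial_union_union (hAB : Disjoint A B) (hAC : Disjoint A C) (hBC : Disjoint B C)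
    (hP : IsSpecial (A ∪ B)) (hQ : IsSpecial (A ∪ C)) :
    (#A + #B = 5 ∧ #A + #C = 5 → #A = 2 ∨ #A = 5) ∧
    (#A + #B = 5 ∧ #A + #C = 6 → #A ≠ 1 ∧ #A ≠ 4) ∧
    (#A + #B = 6 ∧ #A + #C = 5 → #A ≠ 1 ∧ #A ≠ 4) ∧
    (#A = 5 ∧ #B = 1 ∧ #C = 1 → IsSpecial A) ∧
    (#A = 1 ∧ #B = 5 ∧ #C = 5 → IsSpecial B ∨ IsSpecial C) ∧
    (#A = 2 ∧ #B = 3 ∧ #C = 3 → ¬ IsSpecial (B ∪ C)) := by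
  have hP' := card_union_of_disjoint hAB
  have hQ' := card_union_of_disjoint hAC
  have hI : (A ∪ B) ∩ (A ∪ C) = A := by
    rw [← union_inter_distrib_left, disjoint_iff_inter_eq_empty.1 hBC, union_empty]
  have hB : (A ∪ B) \ (A ∪ C) = B := by
    rw [disjoint_left] at hAB hBC
    grind
  have hC : (A ∪ C) \ (A ∪ B) = C := by
    rw [disjoint_left] at hAC hBC
    grind
  refine ⟨fun h => ?_, fun h => ?_, fun h => ?_, fun h => ?_, fun h => ?_, fun h => ?_⟩
  · simpa only [hI] using card_inter_five_five hP hQ (by omega) (by omega)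
  · simpa only [hI] using card_inter_five_six hP hQ (by omega) (by omega)
  · simpa only [inter_comm, hI] using card_inter_five_six hQ hP (by omega) (by omega)
  · simpa only [hI] using hP.inter_of_card hQ (by omega) (by omega) (by rw [hI]; omega)
  · simpa only [hB, hC] using hP.sdiff_or_sdiff hQ (by omega) (by omega) (by rw [hI]; omega)
  · exact not_isSpecial_union_of_five_five hBC hAB.symm hAC.symm (by rwa [union_comm])
      (by rwa [union_comm]) h.2.1 h.2.2 h.1

/-- A special union of two of three disjoint sets forces a special third set or total union. -/
theorem isSpecial_of_union (hAB : Disjoint A B) (hAC : Disjoint A C) (hBC : Disjoint B C)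
    (hP : IsSpecial (A ∪ B)) :
    (#A + #B = 5 ∧ #C = 1 → IsSpecial (A ∪ B ∪ C)) ∧ (#A + #B = 5 ∧ #C = 6 → IsSpecial C) := by
  have hP' := card_union_of_disjoint hAB
  have hW := card_union_of_disjoint (disjoint_union_left.2 ⟨hAC, hBC⟩)
  refine ⟨fun h => hP.of_subset (by omega) subset_union_left (by omega), fun h => ?_⟩
  have hU : (A ∪ B)ᶜ = C := by
    refine (eq_of_subset_of_card_le ?_ ?_).symm
    · rw [subset_compl_iff_disjoint_right]
      exact (disjoint_union_left.2 ⟨hAC, hBC⟩).symm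
    · rw [card_compl, ZMod.card]
      omega
  exact hU ▸ hP.compl (by omega)

/-- The degree of the divisor with coefficient function `e` on the F-curve whose parts not
containing `none` are `A`, `B`, `C`. -/
def fDegree (e : Finset (ZMod 11) → ℤ) (A B C : Finset (ZMod 11)) : ℤ :=
  e (A ∪ B)ᶜ + e (A ∪ C)ᶜ + e (B ∪ C)ᶜ - e Aᶜ - e Bᶜ - e Cᶜ - e (A ∪ B ∪ C)ᶜ

theorem fDegree_swap_left (e : Finset (ZMod 11) → ℤ) : fDegree e B A C = fDegree e A B C := by
  simp only [fDegree, union_comm B A]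
  ring

theorem fDegree_swap_right (e : Finset (ZMod 11) → ℤ) : fDegree e A C B = fDegree e A B C := by
  simp only [fDegree, union_comm C B, union_right_comm A C B]
  ring

set_option maxHeartbeats 4000000 in
theorem fDegree_le_of_card_le (hA : A.Nonempty) (hB : B.Nonempty) (hC : C.Nonempty)
    (hAB : Disjoint A B) (hAC : Disjoint A C) (hBC : Disjoint B C) (hab : #B ≤ #A)
    (hbc : #C ≤ #B) : fDegree dP' A B C ≤ fDegree d0 A B C := by
  have tA := isSpecial_union_union hAB hAC hBC
  have tB := isSpecial_union_union hAB.symm hBC hAC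
  have tC := isSpecial_union_union hAC.symm hBC.symm hAB
  have uC := isSpecial_of_union hAB hAC hBC
  have uB := isSpecial_of_union hAC hAB hBC.symm
  have uA := isSpecial_of_union hBC hAB.symm hAC.symm
  rw [union_comm B A] at tB
  rw [union_comm C A, union_comm C B] at tC
  rw [union_right_comm] at uB
  rw [union_comm _ A, ← union_assoc] at uA
  have cAB := card_union_of_disjoint hAB
  have cAC := card_union_of_disjoint hAC
  have cBC := card_union_of_disjoint hBC
  have cW := card_union_of_disjoint (disjoint_union_left.2 ⟨hAC, hBC⟩)
  have hW : #(A ∪ B ∪ C) ≤ 11 := by simpa [ZMod.card] using card_le_univ (A ∪ B ∪ C)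
  have kAB := fun h => ((dP'_compl_eq_one_iff (A ∪ B)).1 h).card
  have kAC := fun h => ((dP'_compl_eq_one_iff (A ∪ C)).1 h).card
  have kBC := fun h => ((dP'_compl_eq_one_iff (B ∪ C)).1 h).card
  simp only [← dP'_compl_eq_one_iff] at tA tB tC uA uB uC
  have zA := dP'_compl_eq_zero_or_one A
  have zB := dP'_compl_eq_zero_or_one B
  have zC := dP'_compl_eq_zero_or_one C
  have zAB := dP'_compl_eq_zero_or_one (A ∪ B)
  have zAC := dP'_compl_eq_zero_or_one (A ∪ C)
  have zBC := dP'_compl_eq_zero_or_one (B ∪ C)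
  have zW := dP'_compl_eq_zero_or_one (A ∪ B ∪ C)
  simp only [fDegree, d0_compl]
  have ha := hA.card_pos
  have hb := hB.card_pos
  have hc := hC.card_pos
  rw [cAB] at kAB cW
  rw [cAC] at kAC
  rw [cBC] at kBC
  rw [cW] at hW
  rw [cAB, cAC, cBC, cW]
  clear cAB cAC cBC cW
  generalize dP' Aᶜ = x, dP' Bᶜ = y, dP' Cᶜ = z, dP' (A ∪ B)ᶜ = p, dP' (A ∪ C)ᶜ = q,
    dP' (B ∪ C)ᶜ = r, dP' (A ∪ B ∪ C)ᶜ = w, #A = a, #B = b, #C = c at *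
  clear hA hB hC hAB hAC hBC
  have ha' : a ≤ 9 := by omega
  have hb' : b ≤ 5 := by omega
  have hc' : c ≤ 3 := by omega
  interval_cases c <;> interval_cases b <;> interval_cases a <;> simp at * <;> omega

theorem fDegree_dP'_le_fDegree_d0 (hA : A.Nonempty) (hB : B.Nonempty) (hC : C.Nonempty)
    (hAB : Disjoint A B) (hAC : Disjoint A C) (hBC : Disjoint B C) :
    fDegree dP' A B C ≤ fDegree d0 A B C := by
  wlog hab : #B ≤ #A generalizing A B
  · rw [← fDegree_swap_left, ← fDegree_swap_left d0]
    exact this hB hA hAB.symm hBC hAC (by omega)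
  rcases le_total #C #B with hbc | hbc
  · exact fDegree_le_of_card_le hA hB hC hAB hAC hBC hab hbc
  · rw [← fDegree_swap_right, ← fDegree_swap_right d0]
    rcases le_total #C #A with hac | hac
    · exact fDegree_le_of_card_le hA hC hB hAC hAB hBC.symm hac hbc
    · rw [← fDegree_swap_left, ← fDegree_swap_left d0]
      exact fDegree_le_of_card_le hC hA hB hAC.symm hBC.symm hAB hac hab

end

theorem extendCoeff_compl (e : Finset (ZMod 11) → ℤ) (T : Finset X) :
    extendCoeff e Tᶜ = extendCoeff e T := by
  by_cases h : none ∈ T <;> simp [extendCoeff, h]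

theorem extendCoeff_of_none_notMem (e : Finset (ZMod 11) → ℤ) {T : Finset X} (h : none ∉ T) :
    extendCoeff e T = e (eraseNone T)ᶜ := by
  rw [extendCoeff, if_neg h]
  congr 1
  ext
  simp

section
variable {A₁ A₂ A₃ A₄ : Finset X}

theorem degree_eq_fDegree (e : Finset (ZMod 11) → ℤ)
    (h₁₄ : Disjoint A₁ A₄) (h₂₄ : Disjoint A₂ A₄) (h₃₄ : Disjoint A₃ A₄)
    (h₁₂ : Disjoint A₁ A₂) (h₁₃ : Disjoint A₁ A₃)
    (hU : A₁ ∪ A₂ ∪ A₃ ∪ A₄ = Finset.univ) (h : none ∈ A₄) :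
    extendCoeff e (A₁ ∪ A₂) + extendCoeff e (A₁ ∪ A₃) + extendCoeff e (A₁ ∪ A₄)
        - extendCoeff e A₁ - extendCoeff e A₂ - extendCoeff e A₃ - extendCoeff e A₄ =
      fDegree e (eraseNone A₁) (eraseNone A₂) (eraseNone A₃) := by
  have h₁ := disjoint_right.1 h₁₄ h
  have h₂ := disjoint_right.1 h₂₄ h
  have h₃ := disjoint_right.1 h₃₄ h
  have e₄ : A₄ = (A₁ ∪ A₂ ∪ A₃)ᶜ :=
    (IsCompl.compl_eq ⟨by simp only [disjoint_union_left, true_and, *], codisjoint_iff.2 hU⟩).symm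
  have e₁₄ : A₁ ∪ A₄ = (A₂ ∪ A₃)ᶜ :=
    (IsCompl.compl_eq ⟨by simp [h₁₂.symm, h₁₃.symm, h₂₄, h₃₄], codisjoint_iff.2 (by
      rw [top_eq_univ, ← hU]; ext; simp; tauto)⟩).symm
  rw [e₁₄, e₄, extendCoeff_compl, extendCoeff_compl]
  simp [fDegree, extendCoeff_of_none_notMem, h₁, h₂, h₃, eraseNone_union]

theorem degree_le_of_none_mem (h₁ : A₁.Nonempty) (h₂ : A₂.Nonempty) (h₃ : A₃.Nonempty)
    (h₁₂ : Disjoint A₁ A₂) (h₁₃ : Disjoint A₁ A₃) (h₁₄ : Disjoint A₁ A₄)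
    (h₂₃ : Disjoint A₂ A₃) (h₂₄ : Disjoint A₂ A₄) (h₃₄ : Disjoint A₃ A₄)
    (hU : A₁ ∪ A₂ ∪ A₃ ∪ A₄ = Finset.univ) (h : none ∈ A₄) :
    extendCoeff dP' (A₁ ∪ A₂) + extendCoeff dP' (A₁ ∪ A₃) + extendCoeff dP' (A₁ ∪ A₄)
        - extendCoeff dP' A₁ - extendCoeff dP' A₂ - extendCoeff dP' A₃ - extendCoeff dP' A₄ ≤
      extendCoeff d0 (A₁ ∪ A₂) + extendCoeff d0 (A₁ ∪ A₃) + extendCoeff d0 (A₁ ∪ A₄)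
        - extendCoeff d0 A₁ - extendCoeff d0 A₂ - extendCoeff d0 A₃ - extendCoeff d0 A₄ := by
  have ne {T : Finset X} (hT : T.Nonempty) (hd : Disjoint T A₄) : (eraseNone T).Nonempty := by
    obtain ⟨_ | a, ha⟩ := hT
    · exact absurd h (disjoint_left.1 hd ha)
    · exact ⟨a, mem_eraseNone.2 ha⟩
  have dj {S T : Finset X} (hd : Disjoint S T) : Disjoint (eraseNone S) (eraseNone T) := by
    rw [disjoint_left] at hd ⊢
    intro a
    simpa using @hd (some a)
  rw [degree_eq_fDegree dP' h₁₄ h₂₄ h₃₄ h₁₂ h₁₃ hU h,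
    degree_eq_fDegree d0 h₁₄ h₂₄ h₃₄ h₁₂ h₁₃ hU h]
  exact fDegree_dP'_le_fDegree_d0 (ne h₁ h₁₄) (ne h₂ h₂₄) (ne h₃ h₃₄) (dj h₁₂) (dj h₁₃) (dj h₂₃)

theorem extendCoeff_union_eq (e : Finset (ZMod 11) → ℤ)
    (h₁₃ : Disjoint A₁ A₃) (h₁₄ : Disjoint A₁ A₄) (h₂₃ : Disjoint A₂ A₃) (h₂₄ : Disjoint A₂ A₄)
    (hU : A₁ ∪ A₂ ∪ A₃ ∪ A₄ = Finset.univ) :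
    extendCoeff e (A₁ ∪ A₂) = extendCoeff e (A₃ ∪ A₄) := by
  have h : (A₁ ∪ A₂)ᶜ = A₃ ∪ A₄ :=
    IsCompl.compl_eq ⟨by simp [h₁₃, h₁₄, h₂₃, h₂₄], codisjoint_iff.2 (by
      rw [top_eq_univ, ← hU, sup_eq_union, union_assoc _ A₃])⟩
  rw [← extendCoeff_compl, h]

end

/-- On every F-curve, the degree of `D₀` is at least the degree of `D'_𝒫`. -/
theorem D0_F_degree_ge_DP' (A₁ A₂ A₃ A₄ : Finset X)
    (h₁ : A₁.Nonempty) (h₂ : A₂.Nonempty) (h₃ : A₃.Nonempty) (h₄ : A₄.Nonempty)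
    (h₁₂ : Disjoint A₁ A₂) (h₁₃ : Disjoint A₁ A₃) (h₁₄ : Disjoint A₁ A₄)
    (h₂₃ : Disjoint A₂ A₃) (h₂₄ : Disjoint A₂ A₄) (h₃₄ : Disjoint A₃ A₄)
    (hU : A₁ ∪ A₂ ∪ A₃ ∪ A₄ = Finset.univ) :
    extendCoeff d0 (A₁ ∪ A₂) + extendCoeff d0 (A₁ ∪ A₃) + extendCoeff d0 (A₁ ∪ A₄)
        - extendCoeff d0 A₁ - extendCoeff d0 A₂ - extendCoeff d0 A₃
        - extendCoeff d0 A₄ ≥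
      extendCoeff dP' (A₁ ∪ A₂) + extendCoeff dP' (A₁ ∪ A₃) + extendCoeff dP' (A₁ ∪ A₄)
        - extendCoeff dP' A₁ - extendCoeff dP' A₂ - extendCoeff dP' A₃
        - extendCoeff dP' A₄ := by
  have e (e) := extendCoeff_union_eq e h₁₃ h₁₄ h₂₃ h₂₄ hU
  have e' (e) := extendCoeff_union_eq e h₁₂ h₁₄ h₂₃.symm h₃₄ (by rwa [union_right_comm A₁])
  have e'' (e) := extendCoeff_union_eq e h₁₂ h₁₃ h₂₄.symm h₃₄.symm
    (by rw [← hU]; ext; simp; tauto)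
  have hn : none ∈ A₁ ∪ A₂ ∪ A₃ ∪ A₄ := hU ▸ mem_univ _
  simp only [mem_union] at hn
  rcases hn with ((hn | hn) | hn) | hn
  · have := degree_le_of_none_mem h₄ h₂ h₃ h₂₄.symm h₃₄.symm h₁₄.symm h₂₃ h₁₂.symm h₁₃.symm
      (by rw [← hU]; ext; simp; tauto) hn
    simp only [union_comm A₄, ← e, ← e', e''] at this ⊢
    linarith
  · have := degree_le_of_none_mem h₁ h₄ h₃ h₁₄ h₁₃ h₁₂ h₃₄.symm h₂₄.symm h₂₃.symm
      (by rw [← hU]; ext; simp; tauto) hn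
    linarith
  · have := degree_le_of_none_mem h₁ h₂ h₄ h₁₂ h₁₄ h₁₃ h₂₄ h₂₃ h₃₄.symm
      (by rw [← hU]; ext; simp; tauto) hn
    linarith
  · have := degree_le_of_none_mem h₁ h₂ h₃ h₁₂ h₁₃ h₁₄ h₂₃ h₂₄ h₃₄ hU hn
    linarith
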